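/- Under the standing hypotheses, every cycle of length g in G shares an edge with some cycle of length g+1 in G. -/

import Mathlib

open SimpleGraph

/-- Two graphs have the same `k`-deck if there is a bijection between their `k`-element
vertex subsets under which corresponding induced subgraphs are isomorphic. -/
def SameDeck {V W : Type*} [Fintype V] [Fintype W] [DecidableEq V] [DecidableEq W]
    (G : SimpleGraph V) (H : SimpleGraph W) (k : ℕ) : Prop :=
  ∃ e : {s : Finset V // s.card = k} ≃ {s : Finset W // s.card = k},
    ∀ s : {s : Finset V // s.card = k},
      Nonempty ((G.induce (↑s.1 : Set V)) ≃g (H.induce (↑(e s).1 : Set W)))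

/-- `G` has a cycle of length `g` whose vertex set is `S`. -/
def HasCycleOn {V : Type*} (G : SimpleGraph V) (g : ℕ) (S : Set V) : Prop :=
  ∃ (v : V) (C : G.Walk v v), C.IsCycle ∧ C.length = g ∧ ∀ x, x ∈ C.support ↔ x ∈ S

/-- `G` has a path of length `L` from `p` to `q` whose vertex set is `S`. -/
def HasPathOn {V : Type*} (G : SimpleGraph V) (p q : V) (L : ℕ) (S : Set V) : Prop :=
  ∃ R : G.Walk p q, R.IsPath ∧ R.length = L ∧ ∀ x, x ∈ R.support ↔ x ∈ S

namespace HasPathOn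

variable {V : Type*} {G H : SimpleGraph V} {p q u : V} {L : ℕ} {S : Set V}

lemma left_mem (h : HasPathOn G p q L S) : p ∈ S := by
  obtain ⟨R, -, -, hS⟩ := h
  exact (hS p).1 R.start_mem_support

lemma right_mem (h : HasPathOn G p q L S) : q ∈ S := by
  obtain ⟨R, -, -, hS⟩ := h
  exact (hS q).1 R.end_mem_support

lemma symm (h : HasPathOn G p q L S) : HasPathOn G q p L S := by
  obtain ⟨R, hp, hL, hS⟩ := h
  exact ⟨R.reverse, hp.reverse, by simpa using hL, by simpa using hS⟩

lemma of_adj (h : G.Adj p q) : HasPathOn G p q 1 {p, q} :=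
  ⟨Walk.cons h Walk.nil, by simp [h.ne], rfl, by simp⟩

lemma eq_of_zero (h : HasPathOn G p q 0 S) : p = q := by
  obtain ⟨R, -, hL, -⟩ := h
  exact Walk.eq_of_length_eq_zero hL

lemma adj_of_one (h : HasPathOn G p q 1 S) : G.Adj p q := by
  obtain ⟨R, -, hL, -⟩ := h
  exact Walk.adj_of_length_eq_one hL

lemma cons (h : HasPathOn G p q L S) (hu : G.Adj u p) (huS : u ∉ S) :
    HasPathOn G u q (L + 1) (insert u S) := by
  obtain ⟨R, hp, hL, hS⟩ := h
  refine ⟨Walk.cons hu R, ?_, by simp [hL], by simp [hS]⟩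
  rw [Walk.cons_isPath_iff]
  exact ⟨hp, fun h => huS ((hS u).1 h)⟩

lemma uncons (h : HasPathOn G u q L S) (huq : u ≠ q) :
    ∃ p L' S', G.Adj u p ∧ HasPathOn G p q L' S' ∧ L = L' + 1 ∧ S = insert u S' ∧ u ∉ S' := by
  obtain ⟨R, hp, hL, hS⟩ := h
  cases R with
  | nil => exact absurd rfl huq
  | cons hadj R =>
    rw [Walk.cons_isPath_iff] at hp
    refine ⟨_, _, {x | x ∈ R.support}, hadj, ⟨R, hp.1, rfl, fun _ => Iff.rfl⟩,
      by simpa using hL.symm, ?_, hp.2⟩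
    ext x
    simp [← hS]

lemma mono_graph (h : HasPathOn G p q L S)
    (hGH : ∀ x ∈ S, ∀ y ∈ S, G.Adj x y → H.Adj x y) : HasPathOn H p q L S := by
  obtain ⟨R, hp, hL, hS⟩ := h
  have hE : ∀ e ∈ R.edges, e ∈ H.edgeSet := by
    intro e
    induction e with
    | h x y =>
      intro he
      exact hGH x ((hS x).1 (R.fst_mem_support_of_mem_edges he)) y
        ((hS y).1 (R.snd_mem_support_of_mem_edges he)) (R.adj_of_mem_edges he)
  exact ⟨R.transfer H hE, hp.transfer hE, by simpa using hL, by simpa using hS⟩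

lemma split (h : HasPathOn G p q L S) (hu : u ∈ S) :
    ∃ L₁ L₂ S₁ S₂, HasPathOn G p u L₁ S₁ ∧ HasPathOn G u q L₂ S₂ ∧ L₁ + L₂ = L ∧
      S₁ ∪ S₂ = S ∧ S₁ ∩ S₂ = {u} := by
  classical
  obtain ⟨R, hp, hL, hS⟩ := h
  have huR := (hS u).2 hu
  refine ⟨_, _, {x | x ∈ (R.takeUntil u huR).support}, {x | x ∈ (R.dropUntil u huR).support},
    ⟨R.takeUntil u huR, hp.takeUntil huR, rfl, fun _ => Iff.rfl⟩,
    ⟨R.dropUntil u huR, hp.dropUntil huR, rfl, fun _ => Iff.rfl⟩, ?_, ?_, ?_⟩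
  · rw [← Walk.length_append, Walk.take_spec, hL]
  · ext x
    rw [← hS, Set.mem_union, Set.mem_ofPred_eq, Set.mem_ofPred_eq, ← Walk.mem_support_append_iff,
      Walk.take_spec]
  · ext x
    constructor
    · rintro ⟨h1, h2⟩
      have hnd := hp.support_nodup
      rw [← Walk.take_spec R huR, Walk.support_append] at hnd
      have hdis := (List.nodup_append'.1 hnd).2.2
      by_contra hne
      refine hdis h1 ?_
      have h2' : x ∈ (R.dropUntil u huR).support := h2
      rw [Walk.mem_support_iff] at h2'
      exact h2'.resolve_left hne
    · rintro rfl
      exact ⟨Walk.end_mem_support _, Walk.start_mem_support _⟩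

lemma exists_cycle (h : HasPathOn G p q L S) (hp : G.Adj u p) (hq : G.Adj u q) (hu : u ∉ S)
    (hpq : p ≠ q) :
    ∃ C : G.Walk u u, C.IsCycle ∧ C.length = L + 2 ∧ s(u, p) ∈ C.edges ∧ s(u, q) ∈ C.edges ∧
      ∀ x, x ∈ C.support ↔ x ∈ insert u S := by
  obtain ⟨R, hR, hL, hS⟩ := h
  have huR : u ∉ R.support := fun h => hu ((hS u).1 h)
  refine ⟨Walk.cons hp (R.concat hq.symm), ?_, ?_, ?_, ?_, ?_⟩
  · rw [Walk.cons_isCycle_iff]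
    refine ⟨hR.concat huR _, ?_⟩
    rw [Walk.edges_concat]
    simp only [List.concat_eq_append, List.mem_append, List.mem_singleton, not_or]
    refine ⟨fun h => huR (R.fst_mem_support_of_mem_edges h), ?_⟩
    intro h
    rw [Sym2.eq_iff] at h
    rcases h with ⟨-, h⟩ | ⟨-, h⟩
    · exact hp.ne h.symm
    · exact hpq h
  · simp [hL]
  · simp
  · simp [Walk.edges_concat, Sym2.eq_swap]
  · intro x
    simp only [Walk.support_cons, Walk.support_concat, List.mem_cons, List.mem_append,
      Set.mem_insert_iff, hS]
    simp
    tauto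

lemma le_length_of_adj (h : HasPathOn G p q L S) {g : ℕ} (hg : (g : ℕ∞) ≤ G.egirth)
    (hp : G.Adj u p) (hq : G.Adj u q) (hu : u ∉ S) (hpq : p ≠ q) : g ≤ L + 2 := by
  obtain ⟨C, hC, hl, -⟩ := h.exists_cycle hp hq hu hpq
  have := hg.trans (egirth_le_length hC)
  rw [hl] at this
  exact_mod_cast this

lemma hasCycleOn (h : HasPathOn G p q L S) (hp : G.Adj u p) (hq : G.Adj u q) (hu : u ∉ S)
    (hpq : p ≠ q) : HasCycleOn G (L + 2) (insert u S) := by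
  obtain ⟨C, hC, hl, -, -, hS⟩ := h.exists_cycle hp hq hu hpq
  exact ⟨u, C, hC, hl, hS⟩

end HasPathOn

lemma exists_hasPathOn_of_isCycle {V : Type*} {G : SimpleGraph V} {u : V} {C : G.Walk u u}
    (hC : C.IsCycle) :
    ∃ p q L S, G.Adj u p ∧ G.Adj u q ∧ p ≠ q ∧ u ∉ S ∧ HasPathOn G p q L S ∧ C.length = L + 2 ∧
      s(u, p) ∈ C.edges ∧ s(u, q) ∈ C.edges ∧ ∀ x, x ∈ C.support ↔ x ∈ insert u S := by
  cases C with
  | nil => exact absurd hC (by simp)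
  | cons hp P =>
    rename_i p
    rw [Walk.cons_isCycle_iff] at hC
    have hP : HasPathOn G u p P.length {x | x ∈ P.support} :=
      HasPathOn.symm ⟨P, hC.1, rfl, fun _ => Iff.rfl⟩
    obtain ⟨R, hR, hRe⟩ : ∃ R : G.Walk u p, R.IsPath ∧ R = P.reverse := ⟨_, hC.1.reverse, rfl⟩
    cases R with
    | nil => exact absurd rfl hp.ne
    | cons hq R =>
      rename_i q
      rw [Walk.cons_isPath_iff] at hR
      have hPe : P = (Walk.cons hq R).reverse := by rw [hRe, Walk.reverse_reverse]
      refine ⟨p, q, R.length, {x | x ∈ R.support}, hp, hq, ?_, hR.2,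
        HasPathOn.symm ⟨R, hR.1, rfl, fun _ => Iff.rfl⟩, ?_, ?_, ?_, ?_⟩
      · rintro rfl
        apply hC.2
        rw [hPe, Walk.edges_reverse]
        simp
      · simp [hPe]
      · simp
      · rw [hPe, Walk.edges_cons, Walk.edges_reverse]
        simp
      · intro x
        rw [hPe, Walk.support_cons, Walk.support_reverse]
        simp
        tauto

lemma HasCycleOn.exists_hasPathOn {V : Type*} {G : SimpleGraph V} {g : ℕ} {S : Set V}
    (h : HasCycleOn G g S) {u : V} (hu : u ∈ S) :
    ∃ p q L T, G.Adj u p ∧ G.Adj u q ∧ p ≠ q ∧ u ∉ T ∧ HasPathOn G p q L T ∧ g = L + 2 ∧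
      S = insert u T := by
  classical
  obtain ⟨v, C, hC, hl, hS⟩ := h
  have huC := (hS u).2 hu
  obtain ⟨p, q, L, T, hp, hq, hpq, huT, hR, hL, -, -, hT⟩ :=
    exists_hasPathOn_of_isCycle ((Walk.isCycle_rotate huC).2 hC)
  refine ⟨p, q, L, T, hp, hq, hpq, huT, hR, ?_, ?_⟩
  · rw [← hl, ← hL, Walk.length_rotate]
  · ext x
    rw [← hT, ← hS, Walk.mem_support_rotate_iff]

lemma HasCycleOn.map {V W : Type*} {G : SimpleGraph V} {H : SimpleGraph W} {g : ℕ} {S : Set V}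
    (h : HasCycleOn G g S) (f : G →g H) (hf : Function.Injective f) :
    HasCycleOn H g (f '' S) := by
  obtain ⟨v, C, hC, hl, hS⟩ := h
  refine ⟨f v, C.map f, (Walk.isCycle_map_iff_of_injective hf).2 hC, by simpa using hl, ?_⟩
  intro x
  simp [Walk.support_map, hS]

lemma HasCycleOn.induce {V : Type*} {G : SimpleGraph V} {g : ℕ} {S T : Set V}
    (h : HasCycleOn G g S) (hST : S ⊆ T) : HasCycleOn (G.induce T) g (Subtype.val ⁻¹' S) := by
  obtain ⟨v, C, hC, hl, hS⟩ := h
  have hCT : ∀ x ∈ C.support, x ∈ T := fun x hx => hST ((hS x).1 hx)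
  have hmap := Walk.map_induce C hCT
  refine ⟨_, C.induce T hCT, ?_, ?_, ?_⟩
  · rw [← Walk.isCycle_map_iff_of_injective (f := (Embedding.induce T).toHom)
      Subtype.val_injective, hmap]
    exact hC
  · rw [← hl, ← Walk.length_map (Embedding.induce T).toHom (C.induce T hCT), hmap]
    rfl
  · intro x
    simp [← hS, Walk.support_induce]

/-- The number of vertex sets of `g`-cycles of `G` contained in `T`. -/
noncomputable def cycleSetCount {V : Type*} (G : SimpleGraph V) (g : ℕ) (T : Set V) : ℕ :=
  {S : Set V | S ⊆ T ∧ HasCycleOn G g S}.ncard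

lemma cycleSetCount_eq_ncard_induce {V : Type*} (G : SimpleGraph V) (g : ℕ) (T : Set V) :
    cycleSetCount G g T = {S : Set T | HasCycleOn (G.induce T) g S}.ncard := by
  rw [cycleSetCount, ← Set.ncard_image_of_injective _
    (Set.image_injective.2 (Subtype.val_injective (p := (· ∈ T))))]
  congr 1
  ext S
  constructor
  · rintro ⟨hST, h⟩
    exact ⟨_, h.induce hST, by simpa using hST⟩
  · rintro ⟨S, h, rfl⟩
    exact ⟨by simp, h.map (Embedding.induce T).toHom Subtype.val_injective⟩

lemma cycleSetCount_eq_of_iso {V W : Type*} {G : SimpleGraph V} {H : SimpleGraph W} (g : ℕ)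
    {T : Set V} {U : Set W} (e : G.induce T ≃g H.induce U) :
    cycleSetCount G g T = cycleSetCount H g U := by
  rw [cycleSetCount_eq_ncard_induce, cycleSetCount_eq_ncard_induce,
    ← Set.ncard_image_of_injective _ (Set.image_injective.2 e.injective)]
  congr 1
  ext S
  constructor
  · rintro ⟨S, h, rfl⟩
    exact h.map e.toHom e.injective
  · intro h
    exact ⟨e.symm '' S, h.map e.symm.toHom e.symm.injective, e.toEquiv.image_symm_image S⟩

lemma SameDeck.exists_equiv_adj_iff {V W : Type*} [Fintype V] [Fintype W] [DecidableEq V]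
    [DecidableEq W] {G : SimpleGraph V} {H : SimpleGraph W} {k : ℕ} (h : SameDeck G H k)
    (hcard : Fintype.card V = Fintype.card W) (s : Finset V) (hs : s.card = k) :
    ∃ φ : V ≃ W, ∀ p ∈ s, ∀ q ∈ s, H.Adj (φ p) (φ q) ↔ G.Adj p q := by
  classical
  obtain ⟨e, he⟩ := h
  obtain ⟨ψ⟩ := he ⟨s, hs⟩
  set t := e ⟨s, hs⟩ with ht
  have hcompl : Fintype.card {x // ¬ x ∈ (s : Set V)} =
      Fintype.card {x // ¬ x ∈ (t.1 : Set W)} := by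
    rw [Fintype.card_subtype_compl, Fintype.card_subtype_compl, hcard]
    simp [hs, t.2]
  let e₁ : {x // x ∈ (s : Set V)} ≃ {x // x ∈ (t.1 : Set W)} := ψ.toEquiv
  let φ : V ≃ W := (Equiv.sumCompl (· ∈ (s : Set V))).symm.trans
    ((Equiv.sumCongr e₁ (Fintype.equivOfCardEq hcompl)).trans
      (Equiv.sumCompl (· ∈ (t.1 : Set W))))
  have hφ : ∀ p (hp : p ∈ s), φ p = (ψ ⟨p, hp⟩).1 := by
    intro p hp
    simp only [φ, Equiv.trans_apply]
    rw [Equiv.sumCompl_symm_apply_of_pos (p := (· ∈ (s : Set V))) (a := p) hp]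
    rfl
  refine ⟨φ, fun p hp q hq => ?_⟩
  rw [hφ p hp, hφ q hq]
  exact ψ.map_adj_iff (v := ⟨p, hp⟩) (w := ⟨q, hq⟩)

lemma SameDeck.comap {V W : Type*} [Fintype V] [Fintype W] [DecidableEq V]
    [DecidableEq W] {G : SimpleGraph V} {H : SimpleGraph W} {k : ℕ} (h : SameDeck G H k)
    (φ : V ≃ W) : SameDeck G (H.comap φ) k := by
  obtain ⟨e, he⟩ := h
  refine ⟨e.trans (Equiv.subtypeEquiv (Equiv.finsetCongr φ.symm) (by simp)), fun s => ?_⟩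
  obtain ⟨ψ⟩ := he s
  refine ⟨ψ.trans ⟨Equiv.subtypeEquiv φ.symm ?_, ?_⟩⟩
  · intro x
    simp
  · intro x y
    change H.Adj (φ (φ.symm x)) (φ (φ.symm y)) ↔ H.Adj x y
    simp

/-- If every vertex set of a `g`-cycle in `H` is one in `G`, then equality of decks forces
the converse for all sets contained in a card. -/
lemma SameDeck.hasCycleOn_of_forall {V : Type*} [Fintype V] [DecidableEq V]
    {G H : SimpleGraph V} {k g : ℕ} (h : SameDeck G H k)
    (hHG : ∀ S, HasCycleOn H g S → HasCycleOn G g S) {S : Set V} (hS : HasCycleOn G g S)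
    (T : Finset V) (hT : T.card = k) (hST : S ⊆ T) : HasCycleOn H g S := by
  obtain ⟨e, he⟩ := h
  by_contra hSH
  have hsub : ∀ T : Set V, {S : Set V | S ⊆ T ∧ HasCycleOn H g S} ⊆
      {S : Set V | S ⊆ T ∧ HasCycleOn G g S} := fun T S h => ⟨h.1, hHG S h.2⟩
  have hlt : ∑ t : {s : Finset V // s.card = k}, cycleSetCount H g (t.1 : Set V) <
      ∑ t : {s : Finset V // s.card = k}, cycleSetCount G g (t.1 : Set V) := by
    refine Finset.sum_lt_sum (fun t _ => Set.ncard_le_ncard (hsub _) (Set.toFinite _))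
      ⟨⟨T, hT⟩, Finset.mem_univ _, Set.ncard_lt_ncard ⟨hsub _, fun h => ?_⟩ (Set.toFinite _)⟩
    have h2 : S ∈ {S : Set V | S ⊆ T ∧ HasCycleOn H g S} := h ⟨hST, hS⟩
    exact hSH h2.2
  refine hlt.ne' (Fintype.sum_equiv e _ _ fun t => ?_)
  obtain ⟨ψ⟩ := he t
  exact cycleSetCount_eq_of_iso g ψ

/-- If `H` arises from `G` by replacing the edges `ub`, `vd` with `ud`, `vb`, where `uv` is an
edge and no `(g+1)`-cycle uses `ua` or `ub`, then each `g`-cycle of `H` has the same vertex set as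
some `g`-cycle of `G`, and it meets `u` only if it meets `v`. -/
lemma hasCycleOn_of_switch {V : Type*} {G H : SimpleGraph V} {g : ℕ} {u v a b c d : V}
    (hg : (g : ℕ∞) ≤ G.egirth) (huv : G.Adj u v) (hua : G.Adj u a) (hub : G.Adj u b)
    (hvc : G.Adj v c) (hvd : G.Adj v d) (hab : a ≠ b) (hcd : c ≠ d)
    (hav : a ≠ v) (hbv : b ≠ v)
    (hHu : ∀ p, H.Adj u p → p = v ∨ p = a ∨ p = d)
    (hHv : ∀ p, H.Adj v p → p = u ∨ p = b ∨ p = c)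
    (hHG : ∀ p q, p ≠ u → p ≠ v → q ≠ u → q ≠ v → H.Adj p q → G.Adj p q)
    (hno : ∀ (C : G.Walk u u), C.IsCycle → C.length = g + 1 →
      s(u, a) ∉ C.edges ∧ s(u, b) ∉ C.edges)
    {S : Set V} (hS : HasCycleOn H g S) : HasCycleOn G g S ∧ (u ∈ S → v ∈ S) := by
  have htr : ∀ {p q L T}, HasPathOn H p q L T → u ∉ T → v ∉ T → HasPathOn G p q L T :=
    fun h hu hv => h.mono_graph fun x hx y hy => hHG x y (ne_of_mem_of_not_mem hx hu)
      (ne_of_mem_of_not_mem hx hv) (ne_of_mem_of_not_mem hy hu) (ne_of_mem_of_not_mem hy hv)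
  have hnov : ∀ {p L T}, HasPathOn G v p L T → u ∉ T → L + 2 = g + 1 → v ≠ p → p ≠ a ∧ p ≠ b := by
    intro p L T h hu hL hvp
    constructor
    · rintro rfl
      obtain ⟨C, hC, hl, -, he, -⟩ := h.exists_cycle huv hua hu hvp
      exact (hno C hC (hl.trans hL)).1 he
    · rintro rfl
      obtain ⟨C, hC, hl, -, he, -⟩ := h.exists_cycle huv hub hu hvp
      exact (hno C hC (hl.trans hL)).2 he
  have hadj : ∀ {q L T}, HasPathOn H v q L T → (q = a ∨ q = d) → q ≠ v → u ∉ T → L + 2 = g →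
      HasCycleOn G g (insert u T) := by
    intro q L T h hq hqv hu hL
    obtain ⟨p, L', T', hvp, hP, rfl, rfl, hvT⟩ := h.uncons hqv.symm
    have huT : u ∉ T' := fun h => hu (Set.mem_insert_of_mem _ h)
    have hPG := htr hP huT hvT
    have hpT := hP.left_mem
    have hp : p = b ∨ p = c := (hHv p hvp).resolve_left (ne_of_mem_of_not_mem hpT huT)
    rcases hp with rfl | rfl <;> rcases hq with rfl | rfl
    · have := hPG.le_length_of_adj hg hub hua huT hab.symm
      omega
    · have h2 := (hPG.symm.cons hvd hvT).hasCycleOn huv hub hu hbv.symm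
      rwa [hL] at h2
    · have h2 := (hPG.cons hvc hvT).hasCycleOn huv hua hu hav.symm
      rwa [hL] at h2
    · have := hPG.le_length_of_adj hg hvc hvd hvT hcd
      omega
  have hnon : ∀ {L T}, HasPathOn H a d L T → u ∉ T → L + 2 = g → False := by
    intro L T h hu hL
    by_cases hv : v ∈ T
    · obtain ⟨L₁, L₂, T₁, T₂, h1, h2, rfl, rfl, hT⟩ := h.split hv
      have hdv : d ≠ v := hvd.ne'
      obtain ⟨p, L₁', T₁', hvp, hP, rfl, rfl, hvT1⟩ := h1.symm.uncons hav.symm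
      obtain ⟨q, L₂', T₂', hvq, hQ, rfl, rfl, hvT2⟩ := h2.uncons hdv.symm
      have hu1 : u ∉ T₁' := fun h => hu (Or.inl (Or.inr h))
      have hpT := hP.left_mem
      have hp : p = b ∨ p = c := (hHv p hvp).resolve_left (ne_of_mem_of_not_mem hpT hu1)
      have hPG := htr hP hu1 hvT1
      rcases hp with rfl | rfl
      · have := hPG.le_length_of_adj hg hub hua hu1 hab.symm
        omega
      · have := (hPG.cons hvc hvT1).le_length_of_adj hg huv hua
          (by simp [huv.ne, hu1]) hav.symm
        omega
    · have hP := (htr h hu hv).symm.cons hvd hv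
      exact (hnov hP (by simp [huv.ne, hu]) (by omega) hav.symm).1 rfl
  by_cases hu : u ∈ S
  · obtain ⟨p, q, L, T, hup, huq, hpq, huT, hP, rfl, rfl⟩ := hS.exists_hasPathOn hu
    rcases hHu p hup with rfl | hp
    · have hq := (hHu q huq).resolve_left hpq.symm
      exact ⟨hadj hP hq hpq.symm huT rfl, fun _ => Or.inr hP.left_mem⟩
    · rcases hHu q huq with rfl | hq
      · exact ⟨hadj hP.symm hp hpq huT rfl, fun _ => Or.inr hP.right_mem⟩
      · exfalso
        rcases hp with rfl | rfl <;> rcases hq with rfl | rfl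
        · exact hpq rfl
        · exact hnon hP huT rfl
        · exact hnon hP.symm huT rfl
        · exact hpq rfl
  · refine ⟨?_, fun h => absurd h hu⟩
    by_cases hv : v ∈ S
    · exfalso
      obtain ⟨p, q, L, T, hvp, hvq, hpq, hvT, hP, rfl, rfl⟩ := hS.exists_hasPathOn hv
      have huT : u ∉ T := fun h => hu (Or.inr h)
      have hPG := htr hP huT hvT
      have hp := (hHv p hvp).resolve_left (ne_of_mem_of_not_mem hP.left_mem huT)
      have hq := (hHv q hvq).resolve_left (ne_of_mem_of_not_mem hP.right_mem huT)
      have hbc : ∀ {L' T}, HasPathOn G b c L' T → u ∉ T → v ∉ T → L' = L → False := by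
        rintro L' T h hu hv rfl
        exact (hnov (h.symm.cons hvc hv) (by simp [huv.ne, hu]) rfl hbv.symm).2 rfl
      rcases hp with rfl | rfl <;> rcases hq with rfl | rfl
      · exact hpq rfl
      · exact hbc hPG huT hvT rfl
      · exact hbc hPG.symm huT hvT rfl
      · exact hpq rfl
    · obtain ⟨w, C, hC, hl, hCS⟩ := hS
      have hE : ∀ e ∈ C.edges, e ∈ G.edgeSet := by
        intro e
        induction e with
        | h x y =>
          intro he
          have hx := (hCS x).1 (C.fst_mem_support_of_mem_edges he)
          have hy := (hCS y).1 (C.snd_mem_support_of_mem_edges he)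
          exact hHG x y (ne_of_mem_of_not_mem hx hu) (ne_of_mem_of_not_mem hx hv)
            (ne_of_mem_of_not_mem hy hu) (ne_of_mem_of_not_mem hy hv) (C.adj_of_mem_edges he)
      exact ⟨w, C.transfer G hE, hC.transfer hE, by simpa using hl, by simpa using hCS⟩

lemma SimpleGraph.IsRegularOfDegree.exists_adj_iff {V : Type*} {G : SimpleGraph V}
    [G.LocallyFinite] (hG : G.IsRegularOfDegree 3) {u p : V} (h : G.Adj u p) :
    ∃ c d, c ≠ d ∧ c ≠ p ∧ d ≠ p ∧ ∀ q, G.Adj u q ↔ q = p ∨ q = c ∨ q = d := by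
  classical
  have hp : p ∈ G.neighborFinset u := by simpa using h
  have hcard : ((G.neighborFinset u).erase p).card = 2 := by
    rw [Finset.card_erase_of_mem hp, G.card_neighborFinset_eq_degree, hG u]
  obtain ⟨c, d, hcd, he⟩ := Finset.card_eq_two.1 hcard
  have hmem : ∀ q, q ∈ (G.neighborFinset u).erase p ↔ q = c ∨ q = d := by simp [he]
  simp only [Finset.mem_erase, mem_neighborFinset] at hmem
  refine ⟨c, d, hcd, ((hmem c).2 (Or.inl rfl)).1, ((hmem d).2 (Or.inr rfl)).1, fun q => ?_⟩
  rw [← hmem]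
  by_cases hq : q = p
  · simp [hq, h]
  · simp [hq]

/-- In `H`, the vertices `u` and `v` are adjacent, `u` is also adjacent to `p` and `q`, and `v` is
also adjacent to `r` and `s`, with no other neighbours. -/
def IsDoubleStar {V : Type*} (H : SimpleGraph V) (u v p q r s : V) : Prop :=
  (∀ x, H.Adj u x ↔ x = v ∨ x = p ∨ x = q) ∧ ∀ x, H.Adj v x ↔ x = u ∨ x = r ∨ x = s

lemma eq_of_isDoubleStar {V : Type*} {G H : SimpleGraph V} {u v : V}
    (hHG : ∀ p q, p ≠ u → p ≠ v → q ≠ u → q ≠ v → (H.Adj p q ↔ G.Adj p q))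
    {a b c d : V} (hG : IsDoubleStar G u v a b c d) (hH : IsDoubleStar H u v a b c d) : H = G := by
  have hu : ∀ x, H.Adj u x ↔ G.Adj u x := fun x => by rw [hH.1, hG.1]
  have hv : ∀ x, H.Adj v x ↔ G.Adj v x := fun x => by rw [hH.2, hG.2]
  ext p q
  by_cases hpu : p = u
  · rw [hpu, hu]
  by_cases hpv : p = v
  · rw [hpv, hv]
  by_cases hqu : q = u
  · rw [hqu, H.adj_comm, G.adj_comm, hu]
  by_cases hqv : q = v
  · rw [hqv, H.adj_comm, G.adj_comm, hv]
  exact hHG p q hpu hpv hqu hqv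

lemma nonempty_iso_of_isDoubleStar_swap {V : Type*} [DecidableEq V] {G H : SimpleGraph V}
    {u v : V}
    (hHG : ∀ p q, p ≠ u → p ≠ v → q ≠ u → q ≠ v → (H.Adj p q ↔ G.Adj p q))
    {a b c d : V} (hG : IsDoubleStar G u v a b c d) (hH : IsDoubleStar H u v c d a b)
    (hdist : [u, v, a, b, c, d].Nodup) : Nonempty (G ≃g H) := by
  have hs : ∀ x y, Equiv.swap u v x = y ↔ x = Equiv.swap u v y := fun x y => by
    rw [Equiv.swap_apply_eq_iff]
  have hfix : ∀ x ∈ [a, b, c, d], Equiv.swap u v x = x := fun x hx =>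
    Equiv.swap_apply_of_ne_of_ne (by grind) (by grind)
  have ha := hfix a (by simp)
  have hb := hfix b (by simp)
  have hc := hfix c (by simp)
  have hd := hfix d (by simp)
  have heq : H.comap (Equiv.swap u v) = G := by
    refine eq_of_isDoubleStar (u := u) (v := v) ?_ hG ⟨fun x => ?_, fun x => ?_⟩
    · intro p q hpu hpv hqu hqv
      rw [comap_adj, Equiv.swap_apply_of_ne_of_ne hpu hpv, Equiv.swap_apply_of_ne_of_ne hqu hqv,
        hHG p q hpu hpv hqu hqv]
    · rw [comap_adj, Equiv.swap_apply_left, hH.2, hs, hs, hs, Equiv.swap_apply_left, ha, hb]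
    · rw [comap_adj, Equiv.swap_apply_right, hH.1, hs, hs, hs, Equiv.swap_apply_right, hc, hd]
  exact ⟨heq ▸ Iso.comap (Equiv.swap u v) H⟩

section Agree

variable {V : Type*} [Fintype V] [DecidableEq V] {G H : SimpleGraph V} [DecidableRel G.Adj]
  [DecidableRel H.Adj] {u v : V}

lemma sum_adj_eq_of_agree (hG : G.IsRegularOfDegree 3) (hH : H.IsRegularOfDegree 3) (huv : u ≠ v)
    (hHG : ∀ p q, p ≠ u → p ≠ v → q ≠ u → q ≠ v → (H.Adj p q ↔ G.Adj p q))
    {p : V} (hpu : p ≠ u) (hpv : p ≠ v) :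
    (if H.Adj p u then 1 else 0) + (if H.Adj p v then 1 else 0) =
      (if G.Adj p u then 1 else 0) + (if G.Adj p v then 1 else 0) := by
  have key : ∀ (A : SimpleGraph V) [DecidableRel A.Adj], A.IsRegularOfDegree 3 →
      (if A.Adj p u then 1 else 0) + (if A.Adj p v then 1 else 0) +
        ∑ q ∈ ({u, v} : Finset V)ᶜ, (if A.Adj p q then 1 else 0) = 3 := by
    intro A _ hA
    rw [← Finset.sum_pair (f := fun q => if A.Adj p q then 1 else 0) huv,
      Finset.sum_add_sum_compl, ← hA p, ← A.card_neighborFinset_eq_degree,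
      A.neighborFinset_eq_filter, Finset.card_filter]
  have h1 := key G hG
  have h2 := key H hH
  have h3 : ∑ q ∈ ({u, v} : Finset V)ᶜ, (if H.Adj p q then 1 else 0) =
      ∑ q ∈ ({u, v} : Finset V)ᶜ, (if G.Adj p q then 1 else 0) := by
    refine Finset.sum_congr rfl fun q hq => ?_
    simp only [Finset.mem_compl, Finset.mem_insert, Finset.mem_singleton, not_or] at hq
    simp only [hHG p q hpu hpv hq.1 hq.2]
  omega

lemma adj_and_sum_adj_of_agree (hG : G.IsRegularOfDegree 3) (hH : H.IsRegularOfDegree 3)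
    (hHG : ∀ p q, p ≠ u → p ≠ v → q ≠ u → q ≠ v → (H.Adj p q ↔ G.Adj p q))
    {a b c d : V} (hstar : IsDoubleStar G u v a b c d) (hdist : [u, v, a, b, c, d].Nodup) :
    H.Adj u v ∧ (∀ p, p ∉ [u, v, a, b, c, d] → ¬ H.Adj u p ∧ ¬ H.Adj v p) ∧
      (∀ p ∈ [a, b, c, d], (H.Adj v p ↔ ¬ H.Adj u p)) ∧
      (if H.Adj u a then 1 else 0) + ((if H.Adj u b then 1 else 0) +
        ((if H.Adj u c then 1 else 0) + (if H.Adj u d then 1 else 0))) = 2 := by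
  have huv : u ≠ v := by grind
  have hGu : ∀ p, G.Adj p u ↔ p = v ∨ p = a ∨ p = b := fun p => by rw [G.adj_comm, hstar.1]
  have hGv : ∀ p, G.Adj p v ↔ p = u ∨ p = c ∨ p = d := fun p => by rw [G.adj_comm, hstar.2]
  have hsum := fun p (h1 : p ≠ u) (h2 : p ≠ v) =>
    sum_adj_eq_of_agree hG hH huv hHG h1 h2
  simp only [hGu, hGv, H.adj_comm _ u, H.adj_comm _ v] at hsum
  have hother : ∀ p, p ∉ [u, v, a, b, c, d] → ¬ H.Adj u p ∧ ¬ H.Adj v p := by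
    intro p hp
    have := hsum p (by grind) (by grind)
    grind
  have hone : ∀ p ∈ [a, b, c, d], (H.Adj v p ↔ ¬ H.Adj u p) := by
    intro p hp
    have := hsum p (by grind) (by grind)
    grind
  have hdeg : ∀ x y, (∀ p, H.Adj x p → p ∈ ({y, a, b, c, d} : Finset V)) →
      ∑ p ∈ ({y, a, b, c, d} : Finset V), (if H.Adj x p then 1 else 0) = 3 := by
    intro x y h
    rw [← hH x, ← H.card_neighborFinset_eq_degree, ← Finset.card_filter]
    congr 1
    ext p
    simpa using h p
  have hu := hdeg u v (by
    intro p hp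
    by_contra hn
    exact (hother p (by have := hp.ne; grind)).1 hp)
  have hv := hdeg v u (by
    intro p hp
    by_contra hn
    exact (hother p (by have := hp.ne; grind)).2 hp)
  rw [Finset.sum_insert (by grind), Finset.sum_insert (by grind), Finset.sum_insert (by grind),
    Finset.sum_insert (by grind), Finset.sum_singleton] at hu hv
  have ha := hone a (by simp)
  have hb := hone b (by simp)
  have hc := hone c (by simp)
  have hd := hone d (by simp)
  have huv' : H.Adj u v := by
    by_contra h
    simp only [H.adj_comm v u, ha, hb, hc, hd, h] at hu hv
    grind
  refine ⟨huv', hother, hone, ?_⟩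
  rw [if_pos huv'] at hu
  omega

lemma isDoubleStar_of_agree (hG : G.IsRegularOfDegree 3) (hH : H.IsRegularOfDegree 3)
    (hHG : ∀ p q, p ≠ u → p ≠ v → q ≠ u → q ≠ v → (H.Adj p q ↔ G.Adj p q))
    {a b c d : V} (hstar : IsDoubleStar G u v a b c d) (hdist : [u, v, a, b, c, d].Nodup) :
    IsDoubleStar H u v a b c d ∨ IsDoubleStar H u v c d a b ∨
      IsDoubleStar H u v a d b c ∨ IsDoubleStar H u v b c a d ∨
      IsDoubleStar H u v a c b d ∨ IsDoubleStar H u v b d a c := by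
  obtain ⟨huv, hother, hone, hsum⟩ := adj_and_sum_adj_of_agree hG hH hHG hstar hdist
  clear hG hH hHG hstar hdist
  have hvu := huv.symm
  have hmem : ∀ x, H.Adj u x ∨ H.Adj v x → x = u ∨ x = v ∨ x ∈ [a, b, c, d] := by
    intro x hx
    by_contra hn
    have := hother x (by simpa using hn)
    tauto
  clear hother
  have finish : ∀ {p q r s : V}, (∀ x, x ∈ [a, b, c, d] ↔ x ∈ [p, q, r, s]) →
      H.Adj u p → H.Adj u q → ¬ H.Adj u r → ¬ H.Adj u s → IsDoubleStar H u v p q r s := by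
    intro p q r s hperm hp hq hr hs
    simp only [hperm] at hone hmem
    have hr' := (hone r (by simp)).2 hr
    have hs' := (hone s (by simp)).2 hs
    have hp' : ¬ H.Adj v p := fun h => (hone p (by simp)).1 h hp
    have hq' : ¬ H.Adj v q := fun h => (hone q (by simp)).1 h hq
    simp only [List.mem_cons, List.not_mem_nil, or_false] at hmem
    constructor
    · intro x
      constructor
      · intro hx
        rcases hmem x (Or.inl hx) with rfl | rfl | rfl | rfl | rfl | rfl
        · exact absurd rfl hx.ne
        all_goals simp_all
      · rintro (rfl | rfl | rfl) <;> assumption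
    · intro x
      constructor
      · intro hx
        rcases hmem x (Or.inr hx) with rfl | rfl | rfl | rfl | rfl | rfl
        · simp
        · exact absurd rfl hx.ne
        all_goals simp_all
      · rintro (rfl | rfl | rfl) <;> assumption
  clear hone hmem
  by_cases h1 : H.Adj u a <;> by_cases h2 : H.Adj u b <;> by_cases h3 : H.Adj u c <;>
    by_cases h4 : H.Adj u d <;> simp [h1, h2, h3, h4] at hsum
  · exact Or.inl (finish (fun x => Iff.rfl) h1 h2 h3 h4)
  · exact Or.inr (Or.inr (Or.inr (Or.inr (Or.inl
      (finish (fun x => by simp only [List.mem_cons]; tauto) h1 h3 h2 h4)))))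
  · exact Or.inr (Or.inr (Or.inl
      (finish (fun x => by simp only [List.mem_cons]; tauto) h1 h4 h2 h3)))
  · exact Or.inr (Or.inr (Or.inr (Or.inl
      (finish (fun x => by simp only [List.mem_cons]; tauto) h2 h3 h1 h4))))
  · exact Or.inr (Or.inr (Or.inr (Or.inr (Or.inr
      (finish (fun x => by simp only [List.mem_cons]; tauto) h2 h4 h1 h3)))))
  · exact Or.inr (Or.inl (finish (fun x => by simp only [List.mem_cons]; tauto) h3 h4 h1 h2))

end Agree

/-- A girth cycle `C` none of whose edges at `u` is in a `(g+1)`-cycle has an outer edge `uv` that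
is the centre of a double star on six distinct vertices, and some vertex other than `v` avoids
`C`. -/
lemma exists_isDoubleStar_of_isCycle {V : Type*} {G : SimpleGraph V} [G.LocallyFinite] {g : ℕ}
    (hG : G.IsRegularOfDegree 3) (hg : (g : ℕ∞) ≤ G.egirth) {u : V} {C : G.Walk u u}
    (hC : C.IsCycle) (hl : C.length = g)
    (hno : ∀ e ∈ C.edges, ∀ D : G.Walk u u, D.IsCycle → D.length = g + 1 → e ∉ D.edges) :
    ∃ v a b c d, IsDoubleStar G u v a b c d ∧ [u, v, a, b, c, d].Nodup ∧
      s(u, a) ∈ C.edges ∧ s(u, b) ∈ C.edges ∧ v ∉ C.support ∧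
      ∃ w, w ∉ C.support ∧ w ≠ v := by
  obtain ⟨a, b, L, T, hua, hub, hab, huT, hP, hL, hea, heb, hCT⟩ := exists_hasPathOn_of_isCycle hC
  have hgL : g = L + 2 := hl.symm.trans hL
  obtain ⟨v, huv, hva, hvb, hNu⟩ :
      ∃ v, G.Adj u v ∧ v ≠ a ∧ v ≠ b ∧ ∀ q, G.Adj u q ↔ q = v ∨ q = a ∨ q = b := by
    obtain ⟨c, d, hcd, hca, hda, hN⟩ := hG.exists_adj_iff hua
    rcases ((hN b).1 hub).resolve_left hab.symm with rfl | rfl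
    · exact ⟨d, (hN d).2 (by simp), hda, hcd.symm, fun q => by rw [hN]; tauto⟩
    · exact ⟨c, (hN c).2 (by simp), hca, hcd, fun q => by rw [hN]; tauto⟩
  obtain ⟨c, d, hcd, hcu, hdu, hNv⟩ := hG.exists_adj_iff huv.symm
  have hvc : G.Adj v c := (hNv c).2 (by simp)
  have hvd : G.Adj v d := (hNv d).2 (by simp)
  have hLpos : L ≠ 0 := by
    rintro rfl
    exact hab hP.eq_of_zero
  have hnadj : ∀ {x y T'}, HasPathOn G x y L T' → G.Adj u x → G.Adj u y → s(u, y) ∈ C.edges →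
      v ≠ x → v ≠ y → ¬ G.Adj v x := by
    intro x y T' hxy hux huy he hvx hvy hadj
    have h1 := (HasPathOn.of_adj hadj).le_length_of_adj hg huv hux
      (by simp [huv.ne, hux.ne]) hvx
    have hL1 : L = 1 := by omega
    subst hL1
    have hxy' := hxy.adj_of_one
    obtain ⟨D, hD, hDl, -, heD, -⟩ :=
      ((HasPathOn.of_adj hxy').cons hadj (by simp [hvx, hvy])).exists_cycle huv huy
        (by simp [huv.ne, hux.ne, huy.ne]) hvy
    exact hno _ he D hD (by omega) heD
  have hnva := hnadj hP hua hub heb hva hvb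
  have hnvb := hnadj hP.symm hub hua hea hvb hva
  have hca : c ≠ a := fun h => hnva (h ▸ hvc)
  have hcb : c ≠ b := fun h => hnvb (h ▸ hvc)
  have hda : d ≠ a := fun h => hnva (h ▸ hvd)
  have hdb : d ≠ b := fun h => hnvb (h ▸ hvd)
  have hvT : v ∉ T := by
    intro hv
    obtain ⟨L₁, L₂, T₁, T₂, h1, h2, rfl, rfl, -⟩ := hP.split hv
    have := h1.le_length_of_adj hg hua huv (fun h => huT (Or.inl h)) hva.symm
    obtain rfl : L₂ = 0 := by omega
    exact hvb h2.eq_of_zero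
  have hcdT : c ∈ T → d ∉ T := by
    intro hc hd
    obtain ⟨L₁, L₂, T₁, T₂, h1, h2, rfl, rfl, -⟩ := hP.split hc
    rcases hd with hd | hd
    · obtain ⟨L₃, L₄, T₃, T₄, h3, h4, rfl, rfl, -⟩ := h1.split hd
      have := h4.le_length_of_adj hg hvd hvc (fun h => hvT (Or.inl (Or.inr h))) hcd.symm
      obtain rfl : L₂ = 0 := by omega
      exact hcb h2.eq_of_zero
    · obtain ⟨L₃, L₄, T₃, T₄, h3, h4, rfl, rfl, -⟩ := h2.split hd
      have := h3.le_length_of_adj hg hvc hvd (fun h => hvT (Or.inr (Or.inl h))) hcd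
      obtain rfl : L₁ = 0 := by omega
      exact hca h1.eq_of_zero.symm
  refine ⟨v, a, b, c, d, ⟨hNu, hNv⟩, ?_, hea, heb, ?_, ?_⟩
  · have := huv.ne
    have := hua.ne
    have := hub.ne
    have := hvc.ne
    have := hvd.ne
    grind
  · rw [hCT]
    simp [huv.ne', hvT]
  · by_cases hc : c ∈ T
    · exact ⟨d, by rw [hCT]; simp [hdu, hcdT hc], hvd.ne'⟩
    · exact ⟨c, by rw [hCT]; simp [hcu, hc], hvc.ne'⟩

lemma card_compl_pair {V : Type*} [Fintype V] [DecidableEq V] {u v : V} (h : u ≠ v) :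
    (({u, v} : Finset V)ᶜ).card = Fintype.card V - 2 := by
  rw [Finset.card_compl, Finset.card_pair h]

/-- Standing hypotheses: `G` and `H` are 3-regular graphs on the same number `n` of vertices
with the same `(n-2)`-deck, `H` is not isomorphic to `G`, and `g` is the girth of `G`. -/
theorem every_g_cycle_shares_edge_with_g1_cycle
    {V W : Type*} [Fintype V] [Fintype W] [DecidableEq V] [DecidableEq W]
    (G : SimpleGraph V) (H : SimpleGraph W)
    [DecidableRel G.Adj] [DecidableRel H.Adj]
    (hG : G.IsRegularOfDegree 3) (hH : H.IsRegularOfDegree 3)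
    (hcard : Fintype.card V = Fintype.card W)
    (hdeck : SameDeck G H (Fintype.card V - 2))
    (hniso : ¬ Nonempty (G ≃g H))
    (g : ℕ) (hgirth : G.egirth = g)
    :
    ∀ (v₁ : V) (C : G.Walk v₁ v₁), C.IsCycle → C.length = g →
      ∃ (v₂ : V) (D : G.Walk v₂ v₂) (e : Sym2 V),
        D.IsCycle ∧ D.length = g + 1 ∧ e ∈ C.edges ∧ e ∈ D.edges := by
  intro u C hC hl
  by_contra hcon
  have hno : ∀ e ∈ C.edges, ∀ D : G.Walk u u, D.IsCycle → D.length = g + 1 → e ∉ D.edges :=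
    fun e he D hD hDl heD => hcon ⟨u, D, e, hD, hDl, he, heD⟩
  obtain ⟨v, a, b, c, d, hstar, hdist, hea, heb, hvC, w, hwC, hwv⟩ :=
    exists_isDoubleStar_of_isCycle hG hgirth.ge hC hl hno
  have huv : G.Adj u v := (hstar.1 v).2 (by simp)
  obtain ⟨φ, hφ⟩ := hdeck.exists_equiv_adj_iff hcard _ (card_compl_pair huv.ne)
  have hdeck' := hdeck.comap φ
  have hreg : (H.comap φ).IsRegularOfDegree 3 := fun x => by
    rw [← hH (φ x)]
    exact ((Iso.comap φ H).degree_eq x).symm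
  have hniso' : ¬ Nonempty (G ≃g H.comap φ) := fun ⟨e⟩ => hniso ⟨e.trans (Iso.comap φ H)⟩
  have hHG : ∀ p q, p ≠ u → p ≠ v → q ≠ u → q ≠ v → ((H.comap φ).Adj p q ↔ G.Adj p q) :=
    fun p q h1 h2 h3 h4 => hφ p (by simp [h1, h2]) q (by simp [h3, h4])
  have main : ∀ {a b c d : V}, IsDoubleStar G u v a b c d → [u, v, a, b, c, d].Nodup →
      s(u, a) ∈ C.edges → s(u, b) ∈ C.edges → ¬ IsDoubleStar (H.comap φ) u v a d b c := by
    intro a b c d hstar hdist hea heb hH'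
    have hsw : ∀ {S}, HasCycleOn (H.comap φ) g S → HasCycleOn G g S ∧ (u ∈ S → v ∈ S) :=
      hasCycleOn_of_switch hgirth.ge huv ((hstar.1 a).2 (by simp)) ((hstar.1 b).2 (by simp))
        ((hstar.2 c).2 (by simp)) ((hstar.2 d).2 (by simp)) (by grind) (by grind) (by grind)
        (by grind) (fun p => (hH'.1 p).1) (fun p => (hH'.2 p).1)
        (fun p q h1 h2 h3 h4 => (hHG p q h1 h2 h3 h4).1)
        (fun D hD hDl => ⟨hno _ hea D hD hDl, hno _ heb D hD hDl⟩)
    have hCH := hdeck'.hasCycleOn_of_forall (fun S h => (hsw h).1) (S := {x | x ∈ C.support})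
      ⟨u, C, hC, hl, fun _ => Iff.rfl⟩ _ (card_compl_pair hwv) (by
        intro x hx
        simp only [Finset.coe_compl, Finset.coe_pair, Set.mem_compl_iff, Set.mem_insert_iff,
          Set.mem_singleton_iff, not_or]
        exact ⟨ne_of_mem_of_not_mem hx hwC, ne_of_mem_of_not_mem hx hvC⟩)
    exact hvC ((hsw hCH).2 C.start_mem_support)
  have hswapab : ∀ {a b c d}, IsDoubleStar G u v a b c d → IsDoubleStar G u v b a c d :=
    fun h => ⟨fun x => by rw [h.1]; tauto, h.2⟩
  have hswapcd : ∀ {a b c d}, IsDoubleStar G u v a b c d → IsDoubleStar G u v a b d c :=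
    fun h => ⟨h.1, fun x => by rw [h.2]; tauto⟩
  rcases isDoubleStar_of_agree hG hreg hHG hstar hdist with h | h | h | h | h | h
  · exact hniso' (eq_of_isDoubleStar hHG hstar h ▸ ⟨Iso.refl⟩)
  · exact hniso' (nonempty_iso_of_isDoubleStar_swap hHG hstar h hdist)
  · exact main hstar hdist hea heb h
  · exact main (hswapcd (hswapab hstar)) (by grind) heb hea ⟨h.1, h.2⟩
  · exact main (hswapcd hstar) (by grind) hea heb h
  · exact main (hswapab hstar) (by grind) heb hea h
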